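/- Let $K$ be a field, $n\geq 2$, and $a\in U=K[y_1,\ldots,y_n]$. Then the exponential automorphism $\exp(\mathrm{ad}([x_1,x_2]a))$ of $M_n$ equals the composition $D(a)\,\phi_3\cdots\phi_n$, where $D(a)=(x_1+[x_1,x_2]y_1a,\ x_2+[x_1,x_2]y_2a,\ x_3,\ldots,x_n)$ and $\phi_i=(x_1,\ldots,x_{i-1},\ x_i+[x_1,x_2]y_ia,\ x_{i+1},\ldots,x_n)$ for $3\leq i\leq n$. -/

import Mathlib

noncomputable section

/-- The free metabelian Lie algebra of rank `n` over `K`: the quotient of the free Lie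
algebra on `n` generators by its second derived ideal. -/
abbrev FreeMetabelianLie (K : Type) [Field K] (n : ℕ) : Type :=
  FreeLieAlgebra K (Fin n) ⧸ LieAlgebra.derivedSeries K (FreeLieAlgebra K (Fin n)) 2

/-- The free generators `x₁, …, xₙ` of the free metabelian Lie algebra. -/
def xg (K : Type) [Field K] (n : ℕ) (i : Fin n) : FreeMetabelianLie K n :=
  LieSubmodule.Quotient.mk (N := LieAlgebra.derivedSeries K (FreeLieAlgebra K (Fin n)) 2)
    (FreeLieAlgebra.of K i)

/-- The group structure on Lie algebra automorphisms, with `(e * f) x = e (f x)`. -/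
instance lieAutGroup (K : Type) [CommRing K] (L : Type) [LieRing L] [LieAlgebra K L] :
    Group (L ≃ₗ⁅K⁆ L) where
  mul e f := f.trans e
  one := LieEquiv.refl
  inv := LieEquiv.symm
  mul_assoc _ _ _ := LieEquiv.ext fun _ => rfl
  one_mul _ := LieEquiv.ext fun _ => rfl
  mul_one _ := LieEquiv.ext fun _ => rfl
  inv_mul_cancel e := LieEquiv.ext fun x => e.symm_apply_apply x

/-- An automorphism of the free metabelian Lie algebra is elementary if it maps some `xᵢ` to
`α • xᵢ + f`, with `0 ≠ α ∈ K` and `f` in the subalgebra generated by the other generators,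
and fixes all other generators. -/
def IsElementaryAut (K : Type) [Field K] (n : ℕ)
    (φ : FreeMetabelianLie K n ≃ₗ⁅K⁆ FreeMetabelianLie K n) : Prop :=
  ∃ (i : Fin n) (α : K) (f : FreeMetabelianLie K n), α ≠ 0 ∧
    f ∈ LieSubalgebra.lieSpan K (FreeMetabelianLie K n) (xg K n '' {j | j ≠ i}) ∧
    φ (xg K n i) = α • xg K n i + f ∧ ∀ j : Fin n, j ≠ i → φ (xg K n j) = xg K n j

/-- A tame automorphism is one in the subgroup generated by the elementary automorphisms. -/
def IsTame (K : Type) [Field K] (n : ℕ)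
    (φ : FreeMetabelianLie K n ≃ₗ⁅K⁆ FreeMetabelianLie K n) : Prop :=
  φ ∈ Subgroup.closure {ψ | IsElementaryAut K n ψ}

/-- A Chein automorphism (one-row transformation) moves only one generator. -/
def IsCheinAut (K : Type) [Field K] (n : ℕ)
    (φ : FreeMetabelianLie K n ≃ₗ⁅K⁆ FreeMetabelianLie K n) : Prop :=
  ∃ i : Fin n, ∀ j : Fin n, j ≠ i → φ (xg K n j) = xg K n j

/-- An almost tame automorphism is one in the subgroup generated by Chein automorphisms. -/
def IsAlmostTame (K : Type) [Field K] (n : ℕ)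
    (φ : FreeMetabelianLie K n ≃ₗ⁅K⁆ FreeMetabelianLie K n) : Prop :=
  φ ∈ Subgroup.closure {ψ | IsCheinAut K n ψ}

/-- `monoSet K n k` is the set of right-normed Lie monomials of degree `k+1` in the
generators. -/
def monoSet (K : Type) [Field K] (n : ℕ) : ℕ → Set (FreeMetabelianLie K n)
  | 0 => Set.range (xg K n)
  | k + 1 => {z | ∃ u ∈ monoSet K n k, ∃ i : Fin n, z = ⁅u, xg K n i⁆}

/-- `gradePiece K n k` (for `k ≥ 1`) is the homogeneous component `L_k` of the standard
grading: the linear span of the Lie monomials of degree `k` in the generators. -/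
def gradePiece (K : Type) [Field K] (n : ℕ) (k : ℕ) : Submodule K (FreeMetabelianLie K n) :=
  Submodule.span K (monoSet K n (k - 1))

/-- The automorphism `φ = (l₁ + m₁, …, lₙ + mₙ)` (with `lᵢ` linear, `mᵢ ∈ [M,M]`) has lower
degree `≥ d`: each `φ(xᵢ)` lies in `L₁ ⊕ (⨆ k ≥ d, L_k)`. -/
def AutLdegGE (K : Type) [Field K] (n : ℕ)
    (φ : FreeMetabelianLie K n ≃ₗ⁅K⁆ FreeMetabelianLie K n) (d : ℕ) : Prop :=
  ∀ i : Fin n, φ (xg K n i) ∈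
    gradePiece K n 1 ⊔ ⨆ (k : ℕ) (_ : d ≤ k), gradePiece K n k

/-- The action of a polynomial `a ∈ U = K[y₁,…,yₙ]` on `m`; for `m ∈ [M,M]` this is the
canonical `U`-module action on the derived ideal, determined by `m ⬝ yᵢ = ⁅m, xᵢ⁆`. -/
def polyAct (K : Type) [Field K] (n : ℕ) (a : MvPolynomial (Fin n) K)
    (m : FreeMetabelianLie K n) : FreeMetabelianLie K n :=
  ∑ d ∈ a.support, a.coeff d •
    ((List.ofFn fun i : Fin n =>
      (-(LieAlgebra.ad K (FreeMetabelianLie K n) (xg K n i))) ^ (d i)).prod m)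

/-- The polynomial `a` has lower degree `≥ d`: every monomial of `a` has total degree `≥ d`. -/
def PolyLdegGE (K : Type) [Field K] (n : ℕ) (a : MvPolynomial (Fin n) K) (d : ℕ) : Prop :=
  ∀ v ∈ a.support, d ≤ ∑ i, v i

/-- An exponential automorphism: `exp (ad z) = id + ad z` for some `z ∈ [M,M]`. -/
def IsExponentialAut (K : Type) [Field K] (n : ℕ)
    (φ : FreeMetabelianLie K n ≃ₗ⁅K⁆ FreeMetabelianLie K n) : Prop :=
  ∃ z ∈ LieAlgebra.derivedSeries K (FreeMetabelianLie K n) 1,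
    ∀ m : FreeMetabelianLie K n, φ m = m + ⁅z, m⁆

end

noncomputable section

variable {K : Type} [Field K] {n : ℕ}

theorem FreeMetabelianLie.lie_mem_derived (u v : FreeMetabelianLie K n) :
    ⁅u, v⁆ ∈ LieAlgebra.derivedSeries K (FreeMetabelianLie K n) 1 :=
  LieSubmodule.lie_mem_lie (LieSubmodule.mem_top u) (LieSubmodule.mem_top v)

/-- The projection of the free Lie algebra onto the free metabelian Lie algebra. -/
def FreeMetabelianLie.proj (K : Type) [Field K] (n : ℕ) :
    FreeLieAlgebra K (Fin n) →ₗ⁅K⁆ FreeMetabelianLie K n :=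
  { (LieSubmodule.Quotient.mk' (LieAlgebra.derivedSeries K (FreeLieAlgebra K (Fin n)) 2) :
      FreeLieAlgebra K (Fin n) →ₗ[K] FreeMetabelianLie K n) with
    map_lie' := fun {_ _} => rfl }

theorem FreeMetabelianLie.proj_surjective :
    Function.Surjective (FreeMetabelianLie.proj K n) :=
  LieSubmodule.Quotient.surjective_mk' _

theorem FreeMetabelianLie.derivedSeries_two :
    LieAlgebra.derivedSeries K (FreeMetabelianLie K n) 2 = ⊥ := by
  rw [← LieIdeal.derivedSeries_map_eq 2 FreeMetabelianLie.proj_surjective, eq_bot_iff,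
    LieIdeal.map_le_iff_le_comap]
  intro x hx
  rw [LieIdeal.mem_comap]
  exact (LieSubmodule.mem_bot _).2 ((LieSubmodule.Quotient.mk_eq_zero' (m := x)).2 hx)

theorem FreeMetabelianLie.lie_eq_zero {u v : FreeMetabelianLie K n}
    (hu : u ∈ LieAlgebra.derivedSeries K (FreeMetabelianLie K n) 1)
    (hv : v ∈ LieAlgebra.derivedSeries K (FreeMetabelianLie K n) 1) : ⁅u, v⁆ = 0 := by
  have h : ⁅u, v⁆ ∈ LieAlgebra.derivedSeries K (FreeMetabelianLie K n) 2 :=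
    LieSubmodule.lie_mem_lie hu hv
  rwa [FreeMetabelianLie.derivedSeries_two, LieSubmodule.mem_bot] at h

theorem FreeMetabelianLie.hom_ext {F G : FreeMetabelianLie K n →ₗ⁅K⁆ FreeMetabelianLie K n}
    (h : ∀ i, F (xg K n i) = G (xg K n i)) : F = G := by
  have hc : F.comp (FreeMetabelianLie.proj K n) = G.comp (FreeMetabelianLie.proj K n) :=
    FreeLieAlgebra.hom_ext h
  ext m
  obtain ⟨l, rfl⟩ := FreeMetabelianLie.proj_surjective m
  exact LieHom.congr_fun hc l

/-- The Lie algebra endomorphism `id + ad z`, which is `exp (ad z)` for `z` in the derived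
ideal. -/
def FreeMetabelianLie.expAd (z : FreeMetabelianLie K n) :
    FreeMetabelianLie K n →ₗ⁅K⁆ FreeMetabelianLie K n :=
  { LinearMap.id + (LieAlgebra.ad K (FreeMetabelianLie K n) z :
      FreeMetabelianLie K n →ₗ[K] FreeMetabelianLie K n) with
    map_lie' := fun {u v} => by
      have h : ⁅⁅z, u⁆, ⁅z, v⁆⁆ = 0 :=
        FreeMetabelianLie.lie_eq_zero (FreeMetabelianLie.lie_mem_derived _ _)
          (FreeMetabelianLie.lie_mem_derived _ _)
      change ⁅u, v⁆ + ⁅z, ⁅u, v⁆⁆ = ⁅u + ⁅z, u⁆, v + ⁅z, v⁆⁆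
      rw [add_lie, lie_add, lie_add, h, leibniz_lie z u v]
      abel }

theorem FreeMetabelianLie.expAd_apply (z m : FreeMetabelianLie K n) :
    FreeMetabelianLie.expAd z m = m + ⁅z, m⁆ :=
  rfl

/-- The action of the monomial with exponent `d` on the free metabelian Lie algebra, the
factors being restricted to the indices in the list `l`. -/
def monoAct (l : List (Fin n)) (d : Fin n →₀ ℕ) : Module.End K (FreeMetabelianLie K n) :=
  (l.map fun i => (-(LieAlgebra.ad K (FreeMetabelianLie K n) (xg K n i))) ^ d i).prod

theorem monoAct_cons (j : Fin n) (l : List (Fin n)) (d : Fin n →₀ ℕ)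
    (m : FreeMetabelianLie K n) :
    monoAct (j :: l) d m =
      ((-(LieAlgebra.ad K (FreeMetabelianLie K n) (xg K n j))) ^ d j) (monoAct l d m) := by
  simp [monoAct]

theorem pow_neg_ad_mem {S : Submodule K (FreeMetabelianLie K n)} {j : Fin n}
    (hS : ∀ u ∈ S, ⁅u, xg K n j⁆ ∈ S) {m : FreeMetabelianLie K n} (hm : m ∈ S) (k : ℕ) :
    ((-(LieAlgebra.ad K (FreeMetabelianLie K n) (xg K n j))) ^ k) m ∈ S := by
  induction k with
  | zero => simpa using hm
  | succ k ih =>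
    rw [pow_succ', Module.End.mul_apply]
    simpa using hS _ ih

theorem monoAct_mem {S : Submodule K (FreeMetabelianLie K n)}
    (hS : ∀ u ∈ S, ∀ j, ⁅u, xg K n j⁆ ∈ S) {m : FreeMetabelianLie K n} (hm : m ∈ S)
    (l : List (Fin n)) (d : Fin n →₀ ℕ) : monoAct l d m ∈ S := by
  induction l with
  | nil => simpa [monoAct] using hm
  | cons j l ih =>
    rw [monoAct_cons]
    exact pow_neg_ad_mem (fun u hu => hS u hu j) ih _

theorem polyAct_eq_sum (a : MvPolynomial (Fin n) K) (m : FreeMetabelianLie K n) :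
    polyAct K n a m = ∑ d ∈ a.support, a.coeff d • monoAct (List.finRange n) d m := by
  simp only [polyAct, monoAct, List.ofFn_eq_map]

theorem polyAct_mem {S : Submodule K (FreeMetabelianLie K n)}
    (hS : ∀ u ∈ S, ∀ j, ⁅u, xg K n j⁆ ∈ S) {m : FreeMetabelianLie K n} (hm : m ∈ S)
    (a : MvPolynomial (Fin n) K) : polyAct K n a m ∈ S := by
  rw [polyAct_eq_sum]
  exact Submodule.sum_mem _ fun d _ => Submodule.smul_mem _ _ (monoAct_mem hS hm _ _)

theorem polyAct_mem_derived {m : FreeMetabelianLie K n}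
    (hm : m ∈ LieAlgebra.derivedSeries K (FreeMetabelianLie K n) 1)
    (a : MvPolynomial (Fin n) K) :
    polyAct K n a m ∈ LieAlgebra.derivedSeries K (FreeMetabelianLie K n) 1 :=
  polyAct_mem (S := (LieAlgebra.derivedSeries K (FreeMetabelianLie K n) 1).toSubmodule)
    (fun u _ j => FreeMetabelianLie.lie_mem_derived u (xg K n j)) hm a

theorem lie_lie_comm_of_mem_derived {m : FreeMetabelianLie K n}
    (hm : m ∈ LieAlgebra.derivedSeries K (FreeMetabelianLie K n) 1)
    (u v : FreeMetabelianLie K n) : ⁅⁅m, u⁆, v⁆ = ⁅⁅m, v⁆, u⁆ := by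
  have h := FreeMetabelianLie.lie_eq_zero hm (FreeMetabelianLie.lie_mem_derived u v)
  rw [leibniz_lie, ← lie_skew u ⁅m, v⁆] at h
  exact eq_of_sub_eq_zero (by rw [sub_eq_add_neg]; exact h)

theorem pow_neg_ad_lie {m : FreeMetabelianLie K n}
    (hm : m ∈ LieAlgebra.derivedSeries K (FreeMetabelianLie K n) 1) (i j : Fin n) (k : ℕ) :
    ((-(LieAlgebra.ad K (FreeMetabelianLie K n) (xg K n j))) ^ k) ⁅m, xg K n i⁆ =
      ⁅((-(LieAlgebra.ad K (FreeMetabelianLie K n) (xg K n j))) ^ k) m, xg K n i⁆ := by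
  induction k with
  | zero => simp
  | succ k ih =>
    have hk := pow_neg_ad_mem
      (S := (LieAlgebra.derivedSeries K (FreeMetabelianLie K n) 1).toSubmodule) (j := j)
      (fun u _ => FreeMetabelianLie.lie_mem_derived u (xg K n j)) hm k
    rw [pow_succ', Module.End.mul_apply, Module.End.mul_apply, ih]
    simpa using lie_lie_comm_of_mem_derived hk (xg K n i) (xg K n j)

theorem monoAct_add_single {m : FreeMetabelianLie K n}
    (hm : m ∈ LieAlgebra.derivedSeries K (FreeMetabelianLie K n) 1) (i : Fin n)
    (d : Fin n →₀ ℕ) {l : List (Fin n)} (hl : l.Nodup) :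
    monoAct l (Finsupp.single i 1 + d) m =
      if i ∈ l then ⁅monoAct l d m, xg K n i⁆ else monoAct l d m := by
  induction l with
  | nil => simp [monoAct]
  | cons j l ih =>
    have hN := monoAct_mem
      (S := (LieAlgebra.derivedSeries K (FreeMetabelianLie K n) 1).toSubmodule)
      (fun u _ j => FreeMetabelianLie.lie_mem_derived u (xg K n j)) hm l d
    rw [List.nodup_cons] at hl
    rw [monoAct_cons, monoAct_cons, ih hl.2]
    by_cases hij : i = j
    · subst hij
      rw [if_neg hl.1, if_pos List.mem_cons_self, Finsupp.add_apply, Finsupp.single_eq_same,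
        add_comm, pow_succ', Module.End.mul_apply]
      simp
    · simp only [Finsupp.add_apply, Finsupp.single_eq_of_ne' hij, zero_add, List.mem_cons, hij,
        false_or]
      split_ifs
      · exact pow_neg_ad_lie hN i j _
      · rfl

theorem polyAct_add (a b : MvPolynomial (Fin n) K) (m : FreeMetabelianLie K n) :
    polyAct K n (a + b) m = polyAct K n a m + polyAct K n b m := by
  classical
  have hsum : ∀ c : MvPolynomial (Fin n) K, c.support ⊆ a.support ∪ b.support →
      polyAct K n c m =
        ∑ d ∈ a.support ∪ b.support, c.coeff d • monoAct (List.finRange n) d m := by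
    intro c hc
    rw [polyAct_eq_sum]
    refine Finset.sum_subset hc fun d _ hd => ?_
    rw [MvPolynomial.notMem_support_iff.1 hd, zero_smul]
  rw [hsum _ MvPolynomial.support_add, hsum a Finset.subset_union_left,
    hsum b Finset.subset_union_right, ← Finset.sum_add_distrib]
  simp only [MvPolynomial.coeff_add, add_smul]

theorem polyAct_monomial (d : Fin n →₀ ℕ) (c : K) (m : FreeMetabelianLie K n) :
    polyAct K n (MvPolynomial.monomial d c) m = c • monoAct (List.finRange n) d m := by
  classical
  rw [polyAct_eq_sum, MvPolynomial.support_monomial]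
  split_ifs with h <;> simp [h]

theorem polyAct_X_mul {m : FreeMetabelianLie K n}
    (hm : m ∈ LieAlgebra.derivedSeries K (FreeMetabelianLie K n) 1) (i : Fin n)
    (a : MvPolynomial (Fin n) K) :
    polyAct K n (MvPolynomial.X i * a) m = ⁅polyAct K n a m, xg K n i⁆ := by
  induction a using MvPolynomial.induction_on' with
  | monomial d c =>
    rw [MvPolynomial.X, MvPolynomial.monomial_mul, one_mul, polyAct_monomial, polyAct_monomial,
      monoAct_add_single hm i d (List.nodup_finRange n), if_pos (List.mem_finRange i), smul_lie]
  | add p q hp hq => rw [mul_add, polyAct_add, polyAct_add, hp, hq, add_lie]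

theorem map_polyAct_of_map_eq {F : FreeMetabelianLie K n →ₗ⁅K⁆ FreeMetabelianLie K n}
    (hF : ∀ j, F (xg K n j) - xg K n j ∈ LieAlgebra.derivedSeries K (FreeMetabelianLie K n) 1)
    {m : FreeMetabelianLie K n}
    (hm : m ∈ LieAlgebra.derivedSeries K (FreeMetabelianLie K n) 1) (hFm : F m = m)
    (a : MvPolynomial (Fin n) K) : F (polyAct K n a m) = polyAct K n a m := by
  let S : Submodule K (FreeMetabelianLie K n) :=
    (LieAlgebra.derivedSeries K (FreeMetabelianLie K n) 1).toSubmodule ⊓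
      LinearMap.eqLocus (F : FreeMetabelianLie K n →ₗ[K] FreeMetabelianLie K n) LinearMap.id
  have hS : ∀ u ∈ S, ∀ j, ⁅u, xg K n j⁆ ∈ S := by
    rintro u ⟨hu, hFu⟩ j
    refine ⟨FreeMetabelianLie.lie_mem_derived _ _, ?_⟩
    replace hFu : F u = u := hFu
    have h := FreeMetabelianLie.lie_eq_zero hu (hF j)
    rw [lie_sub, sub_eq_zero] at h
    change F ⁅u, xg K n j⁆ = ⁅u, xg K n j⁆
    rw [LieHom.map_lie, hFu, h]
  exact (polyAct_mem hS (m := m) ⟨hm, hFm⟩ a).2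

/-- A composition of one-row transformations `xᵢ ↦ xᵢ + fᵢ`, for distinct indices `i`, all of
which fix every `fⱼ`, is the endomorphism performing all of these transformations at once. -/
theorem exists_foldr_comp_eq (Φ : Fin n → (FreeMetabelianLie K n →ₗ⁅K⁆ FreeMetabelianLie K n))
    (f : Fin n → FreeMetabelianLie K n) {l : List (Fin n)} (hl : l.Nodup)
    (hself : ∀ i ∈ l, Φ i (xg K n i) = xg K n i + f i)
    (hne : ∀ i ∈ l, ∀ j, j ≠ i → Φ i (xg K n j) = xg K n j)
    (hfix : ∀ i ∈ l, ∀ j, Φ i (f j) = f j) :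
    ∃ F : FreeMetabelianLie K n →ₗ⁅K⁆ FreeMetabelianLie K n,
      (l.map fun i => ⇑(Φ i)).foldr (· ∘ ·) id = ⇑F ∧
      (∀ j ∈ l, F (xg K n j) = xg K n j + f j) ∧ ∀ j ∉ l, F (xg K n j) = xg K n j := by
  induction l with
  | nil => exact ⟨LieHom.id, rfl, by simp, fun _ _ => rfl⟩
  | cons i l ih =>
    rw [List.nodup_cons] at hl
    simp only [List.forall_mem_cons] at hself hne hfix
    obtain ⟨F, hF, hFm, hFn⟩ := ih hl.2 hself.2 hne.2 hfix.2
    refine ⟨(Φ i).comp F, ?_, ?_, ?_⟩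
    · rw [List.map_cons, List.foldr_cons, hF, LieHom.coe_comp]
    · rw [List.forall_mem_cons]
      refine ⟨by rw [LieHom.comp_apply, hFn i hl.1, hself.1], fun j hj => ?_⟩
      rw [LieHom.comp_apply, hFm j hj, map_add, hfix.1,
        hne.1 j (ne_of_mem_of_not_mem hj hl.1)]
    · intro j hj
      rw [List.mem_cons, not_or] at hj
      rw [LieHom.comp_apply, hFn j hj.2, hne.1 j hj.1]

theorem List.mem_drop_finRange {k : ℕ} {i : Fin n} :
    i ∈ (List.finRange n).drop k ↔ k ≤ (i : ℕ) := by
  rw [List.mem_drop_iff_getElem]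
  constructor
  · rintro ⟨j, hj, rfl⟩
    simp
  · intro h
    exact ⟨i - k, by simp; omega, by ext; simp; omega⟩

end

open MvPolynomial in
/-- **Decomposition of exponential automorphisms.** For `a ∈ U = K[y₁,…,yₙ]`, the
exponential automorphism `exp(ad([x₁,x₂]a))` equals the composition `D(a) φ₃ ⋯ φₙ`, where
`D(a) = (x₁ + [x₁,x₂]y₁a, x₂ + [x₁,x₂]y₂a, x₃, …, xₙ)` and
`φᵢ = (x₁, …, x_{i-1}, xᵢ + [x₁,x₂]yᵢa, x_{i+1}, …, xₙ)` for `3 ≤ i ≤ n`. -/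
theorem expAd_eq_D_comp_phis (K : Type) [Field K] (n : ℕ) (hn : 2 ≤ n)
    (a : MvPolynomial (Fin n) K)
    (i0 i1 : Fin n) (h0 : (i0 : ℕ) = 0) (h1 : (i1 : ℕ) = 1)
    (D : FreeMetabelianLie K n →ₗ⁅K⁆ FreeMetabelianLie K n)
    (hD0 : D (xg K n i0) = xg K n i0 +
      polyAct K n (X i0 * a) ⁅xg K n i0, xg K n i1⁆)
    (hD1 : D (xg K n i1) = xg K n i1 +
      polyAct K n (X i1 * a) ⁅xg K n i0, xg K n i1⁆)
    (hD : ∀ j : Fin n, j ≠ i0 → j ≠ i1 → D (xg K n j) = xg K n j)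
    (Φ : Fin n → (FreeMetabelianLie K n →ₗ⁅K⁆ FreeMetabelianLie K n))
    (hΦ : ∀ i : Fin n, 2 ≤ (i : ℕ) →
      Φ i (xg K n i) = xg K n i + polyAct K n (X i * a) ⁅xg K n i0, xg K n i1⁆ ∧
      ∀ j : Fin n, j ≠ i → Φ i (xg K n j) = xg K n j) :
    (fun m => m + ⁅polyAct K n a ⁅xg K n i0, xg K n i1⁆, m⁆) =
      ⇑D ∘ ((List.ofFn fun i : Fin n => ⇑(Φ i)).drop 2).foldr (· ∘ ·) id := by
  set w := ⁅xg K n i0, xg K n i1⁆ with hw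
  have hwN : w ∈ LieAlgebra.derivedSeries K (FreeMetabelianLie K n) 1 :=
    FreeMetabelianLie.lie_mem_derived _ _
  have hz := polyAct_mem_derived hwN a
  simp only [polyAct_X_mul hwN] at hD0 hD1 hΦ
  have hDw : D w = w := by
    have h := (FreeMetabelianLie.expAd (polyAct K n a w)).map_lie (xg K n i0) (xg K n i1)
    simp only [FreeMetabelianLie.expAd_apply] at h
    rw [← hw, FreeMetabelianLie.lie_eq_zero hz hwN, add_zero] at h
    conv_lhs => rw [hw]
    rw [LieHom.map_lie, hD0, hD1, ← h]
  have hDfix : ∀ j, D ⁅polyAct K n a w, xg K n j⁆ = ⁅polyAct K n a w, xg K n j⁆ := by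
    intro j
    rw [← polyAct_X_mul hwN]
    refine map_polyAct_of_map_eq (fun k => ?_) hwN hDw _
    by_cases hk0 : k = i0
    · rw [hk0, hD0, add_sub_cancel_left]
      exact FreeMetabelianLie.lie_mem_derived _ _
    by_cases hk1 : k = i1
    · rw [hk1, hD1, add_sub_cancel_left]
      exact FreeMetabelianLie.lie_mem_derived _ _
    rw [hD k hk0 hk1, sub_self]
    exact zero_mem _
  have hΦfix : ∀ i : Fin n, 2 ≤ (i : ℕ) → ∀ j,
      Φ i ⁅polyAct K n a w, xg K n j⁆ = ⁅polyAct K n a w, xg K n j⁆ := by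
    intro i hi j
    have hΦw : Φ i w = w := by
      rw [hw, LieHom.map_lie, (hΦ i hi).2 i0 (by rintro rfl; omega),
        (hΦ i hi).2 i1 (by rintro rfl; omega)]
    rw [← polyAct_X_mul hwN]
    refine map_polyAct_of_map_eq (fun k => ?_) hwN hΦw _
    by_cases hk : k = i
    · rw [hk, (hΦ i hi).1, add_sub_cancel_left]
      exact FreeMetabelianLie.lie_mem_derived _ _
    · rw [(hΦ i hi).2 k hk, sub_self]
      exact zero_mem _
  obtain ⟨F, hF, hFm, hFn⟩ := exists_foldr_comp_eq Φ
    (fun j => ⁅polyAct K n a w, xg K n j⁆) (l := (List.finRange n).drop 2)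
    ((List.nodup_finRange n).sublist (List.drop_sublist _ _))
    (fun i hi => (hΦ i (List.mem_drop_finRange.1 hi)).1)
    (fun i hi => (hΦ i (List.mem_drop_finRange.1 hi)).2)
    (fun i hi => hΦfix i (List.mem_drop_finRange.1 hi))
  rw [List.ofFn_eq_map, ← List.map_drop, hF, ← LieHom.coe_comp]
  suffices h : FreeMetabelianLie.expAd (polyAct K n a w) = D.comp F from congrArg DFunLike.coe h
  refine FreeMetabelianLie.hom_ext fun j => ?_
  rw [FreeMetabelianLie.expAd_apply, LieHom.comp_apply]
  by_cases hj : 2 ≤ (j : ℕ)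
  · rw [hFm j (List.mem_drop_finRange.2 hj), map_add, hDfix,
      hD j (by rintro rfl; omega) (by rintro rfl; omega)]
  · rw [hFn j (mt List.mem_drop_finRange.1 hj)]
    obtain rfl | rfl : j = i0 ∨ j = i1 := by
      simp only [Fin.ext_iff]
      omega
    · exact hD0.symm
    · exact hD1.symm
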